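/- Let l ≥ 1 and, for each multi-index I with |I| = l, let A^I be a smooth function on J^r; set f := Σ_{I : |I| = l} d_I A^I, a smooth function on J^{r+l}. Then E^J_σ(f) = 0 for every σ ∈ Fin m and every multi-index J with |J| ≤ l − 1; in particular the Euler–Lagrange expressions of f vanish: E_σ(f) = 0. -/

import Mathlib

open scoped BigOperators

namespace JetVar

/-- Multi-indices on `Fin n` of degree at most `r`. -/
abbrev MD (n r : ℕ) : Type := {J : Fin n → ℕ // (∑ i, J i) ≤ r}

noncomputable instance (n r : ℕ) : Fintype (MD n r) :=
  Fintype.ofInjective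
    (fun J : MD n r => fun i : Fin n =>
      (⟨J.1 i, Nat.lt_succ_of_le ((Finset.single_le_sum
        (fun j _ => Nat.zero_le (J.1 j)) (Finset.mem_univ i)).trans J.2)⟩ : Fin (r+1)))
    (fun _a _b h => Subtype.ext (funext fun i => congrArg Fin.val (congrFun h i)))

/-- Index set for the `y` coordinates of the `r`-th order jet space. -/
abbrev JIdx (n m r : ℕ) : Type := Fin m × MD n r

/-- The `r`-th order jet coordinate space. -/
abbrev Jet (n m r : ℕ) : Type := ((Fin n) → ℝ) × (JIdx n m r → ℝ)

variable {n m : ℕ}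

/-- The coordinate `x^i`. -/
def xc (i : Fin n) {r : ℕ} (p : Jet n m r) : ℝ := p.1 i

/-- The coordinate `y^σ_J` (with the convention that it is `0` for `|J| > r`). -/
def yc (σ : Fin m) (J : Fin n → ℕ) {r : ℕ} (p : Jet n m r) : ℝ :=
  if h : (∑ i, J i) ≤ r then p.2 (σ, ⟨J, h⟩) else 0

/-- Partial derivative along the coordinate direction `x^i`. -/
noncomputable def pdX (i : Fin n) {r : ℕ} (f : Jet n m r → ℝ) (p : Jet n m r) : ℝ :=
  fderiv ℝ f p (Pi.single i 1, 0)

/-- Partial derivative along the coordinate direction `y^σ_J`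
(by convention `0` for `|J| > r`). -/
noncomputable def pdY (σ : Fin m) (J : Fin n → ℕ) {r : ℕ} (f : Jet n m r → ℝ)
    (p : Jet n m r) : ℝ :=
  if h : (∑ i, J i) ≤ r then fderiv ℝ f p (0, Pi.single (σ, (⟨J, h⟩ : MD n r)) 1) else 0

/-- Projection `J^s → J^r` for `r ≤ s`, forgetting higher order coordinates. -/
def projJet {r s : ℕ} (h : r ≤ s) (p : Jet n m s) : Jet n m r :=
  (p.1, fun q => p.2 (q.1, ⟨q.2.1, q.2.2.trans h⟩))

/-- `J + e_i`. -/
def addE (J : Fin n → ℕ) (i : Fin n) : Fin n → ℕ := fun j => J j + (if j = i then 1 else 0)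

/-- `J - e_i` (truncated subtraction). -/
def subE (J : Fin n → ℕ) (i : Fin n) : Fin n → ℕ := fun j => J j - (if j = i then 1 else 0)

/-- The `i`-th formal (total) derivative of a function on `J^r`, a function on `J^{r+1}`. -/
noncomputable def formalD (i : Fin n) {r : ℕ} (f : Jet n m r → ℝ) (p : Jet n m (r+1)) : ℝ :=
  pdX i f (projJet (Nat.le_succ r) p)
    + ∑ q : JIdx n m r, yc q.1 (addE q.2.1 i) p * pdY q.1 q.2.1 f (projJet (Nat.le_succ r) p)

/-- Iterated formal derivatives along a list of directions. -/
noncomputable def formalDL {r : ℕ} : (l : List (Fin n)) → (Jet n m r → ℝ) →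
    (Jet n m (r + l.length) → ℝ)
  | [], f => f
  | i :: l, f => formalD i (formalDL l f)

/-- The canonical list of directions attached to a multi-index
(each `i` repeated `J i` times, in increasing order of `i`). -/
def mlist (J : Fin n → ℕ) : List (Fin n) :=
  (List.finRange n).flatMap (fun i => List.replicate (J i) i)

lemma mlist_length (J : Fin n → ℕ) : (mlist J).length = ∑ i, J i := by
  rw [mlist, List.length_flatMap]
  simp only [Function.comp_def, List.length_replicate]
  rw [Fin.sum_univ_def]

/-- The iterated formal derivative `d_I`, applying each `d_i` exactly `I i` times
(in increasing order of `i`); a function on `J^{r+|I|}`. -/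
noncomputable def formalDI (I : Fin n → ℕ) {r : ℕ} (f : Jet n m r → ℝ)
    (p : Jet n m (r + ∑ i, I i)) : ℝ :=
  formalDL (mlist I) f (projJet (le_of_eq (by rw [mlist_length])) p)

/-- The Lie–Euler expression `E^I_σ(L)` of a function `L` on `J^r`, a function on `J^{2r}`. -/
noncomputable def LieEuler {r : ℕ} (σ : Fin m) (I : Fin n → ℕ) (L : Jet n m r → ℝ)
    (p : Jet n m (2*r)) : ℝ :=
  ∑ J : MD n r,
    if h : (∑ i, (I i + J.1 i)) ≤ r then
      (-1:ℝ)^(∑ i, J.1 i) * (∏ i, (Nat.choose (I i + J.1 i) (I i) : ℝ)) *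
        formalDI J.1 (pdY σ (fun i => I i + J.1 i) L)
          (projJet (by have := J.2; omega) p)
    else 0

/-- The Euler–Lagrange expression `E_σ(L)`. -/
noncomputable def EL {r : ℕ} (σ : Fin m) (L : Jet n m r → ℝ) : Jet n m (2*r) → ℝ :=
  LieEuler σ (fun _ => 0) L


section Infinite

/-- Infinite jet space. -/
abbrev JInf (n m : ℕ) : Type := (Fin n → ℝ) × (Fin m × (Fin n → ℕ) → ℝ)

lemma sum_addE (J : Fin n → ℕ) (i : Fin n) : ∑ j, addE J i j = (∑ j, J j) + 1 := by
  simp [addE, Finset.sum_add_distrib]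

lemma subE_addE (J : Fin n → ℕ) (i : Fin n) : subE (addE J i) i = J := by
  funext j; simp [subE, addE]

lemma addE_subE (J : Fin n → ℕ) (i : Fin n) (h : J i ≠ 0) : addE (subE J i) i = J := by
  funext j
  by_cases hj : j = i
  · subst hj; simp [subE, addE]; omega
  · simp [subE, addE, hj]

lemma addE_inj (i : Fin n) : Function.Injective (fun J : Fin n → ℕ => addE J i) := fun a b h => by
  rw [← subE_addE a i, ← subE_addE b i]; exact congrArg (fun K => subE K i) h

lemma addE_self_ne (J : Fin n → ℕ) (i : Fin n) : addE J i i ≠ 0 := by simp [addE]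

/-- Projection to finite jets. -/
def piL (r : ℕ) : JInf n m →ₗ[ℝ] Jet n m r where
  toFun p := (p.1, fun q => p.2 (q.1, q.2.1))
  map_add' _ _ := rfl
  map_smul' _ _ := rfl

lemma piL_surj (r : ℕ) (p : Jet n m r) : ∃ P : JInf n m, piL r P = p := by
  refine ⟨(p.1, fun q => yc q.1 q.2 p), ?_⟩
  refine Prod.ext rfl (funext fun q => ?_)
  simp [piL, yc, q.2.2]

lemma projJet_piL {r s : ℕ} (h : r ≤ s) (P : JInf n m) : projJet h (piL s P) = piL r P := rfl

lemma contDiff_projJet {r s : ℕ} (h : r ≤ s) :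
    ContDiff ℝ (⊤:ℕ∞) (projJet h : Jet n m s → Jet n m r) := by
  unfold projJet; fun_prop

/-- Shift on the infinite jets. -/
def shiftL (i : Fin n) : JInf n m →ₗ[ℝ] JInf n m where
  toFun p := (0, fun q => p.2 (q.1, addE q.2 i))
  map_add' _ _ := by ext <;> simp
  map_smul' _ _ := by ext <;> simp

/-- The total derivative vector field. -/
def xi (i : Fin n) (p : JInf n m) : JInf n m := (Pi.single i 1, 0) + shiftL i p

/-- finite version of the vector field -/
def xiF (i : Fin n) (r : ℕ) (p : Jet n m (r+1)) : Jet n m r :=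
  (Pi.single i 1, fun q => p.2 (q.1, ⟨addE q.2.1 i, by rw [sum_addE]; exact Nat.succ_le_succ q.2.2⟩))

lemma piL_xi (i : Fin n) (r : ℕ) (P : JInf n m) : piL r (xi i P) = xiF i r (piL (r+1) P) := by
  refine Prod.ext ?_ (funext fun q => ?_) <;> simp [piL, xi, xiF, shiftL]

lemma contDiff_xiF (i : Fin n) (r : ℕ) : ContDiff ℝ (⊤:ℕ∞) (xiF i r : Jet n m (r+1) → Jet n m r) := by
  unfold xiF; fun_prop

lemma lineDeriv_lift {r : ℕ} {f : Jet n m r → ℝ} (hf : ContDiff ℝ (⊤:ℕ∞) f) (P v : JInf n m) :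
    lineDeriv ℝ (fun Q => f (piL r Q)) P v = fderiv ℝ f (piL r P) (piL r v) := by
  have h : DifferentiableAt ℝ f (piL r P) := (hf.differentiable (by simp)).differentiableAt
  have := h.lineDeriv_eq_fderiv (v := piL r v)
  rw [← this]
  simp [lineDeriv]

/-- The module of smooth local functions. -/
def S (n m : ℕ) : Submodule ℝ (JInf n m → ℝ) where
  carrier := {F | ∃ r, ∃ f : Jet n m r → ℝ, ContDiff ℝ (⊤:ℕ∞) f ∧ F = fun P => f (piL r P)}
  zero_mem' := ⟨0, 0, contDiff_const, rfl⟩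
  add_mem' := by
    rintro _ _ ⟨r, f, hf, rfl⟩ ⟨s, g, hg, rfl⟩
    refine ⟨max r s, fun p => f (projJet (le_max_left r s) p) + g (projJet (le_max_right r s) p),
      (hf.comp (contDiff_projJet _)).add (hg.comp (contDiff_projJet _)), rfl⟩
  smul_mem' := by
    rintro c _ ⟨r, f, hf, rfl⟩
    exact ⟨r, fun p => c * f p, contDiff_const.mul hf, rfl⟩

lemma contDiff_fd {r : ℕ} {f : Jet n m r → ℝ} (hf : ContDiff ℝ (⊤:ℕ∞) f) :
    ContDiff ℝ (⊤:ℕ∞) (fderiv ℝ f) := hf.fderiv_right (by simp)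

lemma ld_add (F G : S n m) (P v : JInf n m) :
    lineDeriv ℝ (F.1 + G.1) P v = lineDeriv ℝ F.1 P v + lineDeriv ℝ G.1 P v := by
  obtain ⟨_, r, f, hf, rfl⟩ := F
  obtain ⟨_, s, g, hg, rfl⟩ := G
  have h1 : LineDifferentiableAt ℝ (fun Q => f (piL r Q)) P v := by
    have : LineDifferentiableAt ℝ f (piL r P) (piL r v) :=
      (hf.differentiable (by simp)).differentiableAt.lineDifferentiableAt
    simpa [LineDifferentiableAt] using this
  have h2 : LineDifferentiableAt ℝ (fun Q => g (piL s Q)) P v := by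
    have : LineDifferentiableAt ℝ g (piL s P) (piL s v) :=
      (hg.differentiable (by simp)).differentiableAt.lineDifferentiableAt
    simpa [LineDifferentiableAt] using this
  exact deriv_add h1 h2

lemma ld_smul (c : ℝ) (F : S n m) (P v : JInf n m) :
    lineDeriv ℝ (c • F.1) P v = c * lineDeriv ℝ F.1 P v := by
  simp [lineDeriv]

lemma ld_v_add (F : S n m) (P v w : JInf n m) :
    lineDeriv ℝ F.1 P (v + w) = lineDeriv ℝ F.1 P v + lineDeriv ℝ F.1 P w := by
  obtain ⟨_, r, f, hf, rfl⟩ := F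
  simp only [lineDeriv_lift hf, map_add]

/-- Constant directional derivative. -/
noncomputable def dV (v : JInf n m) : S n m →ₗ[ℝ] S n m where
  toFun F := ⟨fun P => lineDeriv ℝ F.1 P v, by
    obtain ⟨_, r, f, hf, rfl⟩ := F
    exact ⟨r, fun p => fderiv ℝ f p (piL r v), (contDiff_fd hf).clm_apply contDiff_const,
      funext fun P => lineDeriv_lift hf P v⟩⟩
  map_add' F G := Subtype.ext (funext fun P => ld_add F G P v)
  map_smul' c F := Subtype.ext (funext fun P => ld_smul c F P v)

/-- Total derivative. -/
noncomputable def dT (i : Fin n) : S n m →ₗ[ℝ] S n m where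
  toFun F := ⟨fun P => lineDeriv ℝ F.1 P (xi i P), by
    obtain ⟨_, r, f, hf, rfl⟩ := F
    refine ⟨r+1, fun p => fderiv ℝ f (projJet (Nat.le_succ r) p) (xiF i r p),
      ((contDiff_fd hf).comp (contDiff_projJet _)).clm_apply (contDiff_xiF i r),
      funext fun P => ?_⟩
    simp only
    rw [lineDeriv_lift hf, piL_xi]; rfl⟩
  map_add' F G := Subtype.ext (funext fun P => ld_add F G P _)
  map_smul' c F := Subtype.ext (funext fun P => ld_smul c F P _)

lemma dV_apply (v : JInf n m) (F : S n m) (P) : (dV v F).1 P = lineDeriv ℝ F.1 P v := rfl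
lemma dT_apply (i : Fin n) (F : S n m) (P) : (dT i F).1 P = lineDeriv ℝ F.1 P (xi i P) := rfl

lemma dV_symm (F : S n m) (P v w : JInf n m) :
    lineDeriv ℝ (dV w F).1 P v = lineDeriv ℝ (dV v F).1 P w := by
  obtain ⟨_, r, f, hf, rfl⟩ := F
  have key : ∀ v w : JInf n m, lineDeriv ℝ (dV w ⟨_, r, f, hf, rfl⟩).1 P v =
      fderiv ℝ (fderiv ℝ f) (piL r P) (piL r v) (piL r w) := by
    intro v w
    have h0 : (dV w (⟨_, r, f, hf, rfl⟩ : S n m)).1 = fun P => (fun p => fderiv ℝ f p (piL r w)) (piL r P) :=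
      funext fun P => lineDeriv_lift hf P w
    rw [h0, lineDeriv_lift ((contDiff_fd hf).clm_apply contDiff_const)]
    rw [fderiv_clm_apply ((contDiff_fd hf).differentiable (by simp)).differentiableAt (by fun_prop)]
    simp
  rw [key, key]
  have hs : IsSymmSndFDerivAt ℝ f (piL r P) :=
    hf.contDiffAt.isSymmSndFDerivAt (by
      rw [minSmoothness_of_isRCLikeNormedField]; exact WithTop.coe_le_coe.2 le_top)
  exact hs _ _

lemma deriv_aux {E : Type*} [NormedAddCommGroup E] [NormedSpace ℝ E] (f : E → ℝ) (a b c d : E)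
    (hd : DifferentiableAt ℝ (fderiv ℝ f) a) :
    deriv (fun t : ℝ => fderiv ℝ f (a + t • b) (c + t • d)) 0
      = fderiv ℝ (fderiv ℝ f) a b c + fderiv ℝ f a d := by
  have a1 : HasDerivAt (fun t : ℝ => a + t • b) b 0 := by
    simpa using ((hasDerivAt_id (0:ℝ)).smul_const b).const_add a
  have a2 : HasDerivAt (fun t : ℝ => c + t • d) d 0 := by
    simpa using ((hasDerivAt_id (0:ℝ)).smul_const d).const_add c
  have hd' : HasFDerivAt (fderiv ℝ f) (fderiv ℝ (fderiv ℝ f) a) (a + (0:ℝ) • b) := by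
    simpa using hd.hasFDerivAt
  have a4 : HasDerivAt (fun t : ℝ => fderiv ℝ f (a + t • b)) (fderiv ℝ (fderiv ℝ f) a b) 0 :=
    hd'.comp_hasDerivAt (0:ℝ) a1
  have a3 := a4.clm_apply a2
  have h := a3.deriv
  rw [zero_smul, zero_smul, add_zero, add_zero] at h
  exact h

lemma ld_dT (i : Fin n) (F : S n m) (P v : JInf n m) :
    lineDeriv ℝ (dT i F).1 P v
      = lineDeriv ℝ (dV v F).1 P (xi i P) + lineDeriv ℝ F.1 P (shiftL i v) := by
  rw [← dV_symm]
  obtain ⟨_, r, f, hf, rfl⟩ := F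
  have hd : DifferentiableAt ℝ (fderiv ℝ f) (piL r P) :=
    ((contDiff_fd hf).differentiable (by simp)).differentiableAt
  have hx : ∀ t : ℝ, piL r (xi i (P + t • v)) = piL r (xi i P) + t • piL r (shiftL i v) := by
    intro t
    rw [← map_smul, ← map_add]
    congr 1
    simp [xi, add_assoc]
  have h0 : lineDeriv ℝ (dV (xi i P) (⟨_, r, f, hf, rfl⟩ : S n m)).1 P v
      = deriv (fun t : ℝ => fderiv ℝ f (piL r P + t • piL r v) (piL r (xi i P) + t • 0)) 0 := by
    unfold lineDeriv
    congr 1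
    funext t
    rw [dV_apply, lineDeriv_lift hf, map_add, map_smul, smul_zero, add_zero]
  have h1 : lineDeriv ℝ (dT i (⟨_, r, f, hf, rfl⟩ : S n m)).1 P v
      = deriv (fun t : ℝ => fderiv ℝ f (piL r P + t • piL r v)
        (piL r (xi i P) + t • piL r (shiftL i v))) 0 := by
    unfold lineDeriv
    congr 1
    funext t
    rw [dT_apply, lineDeriv_lift hf, hx, map_add (piL r) P, map_smul (piL r) t v]
  rw [h0, h1, lineDeriv_lift hf, deriv_aux f _ _ _ _ hd, deriv_aux f _ _ _ _ hd, map_zero, add_zero]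

lemma shift_xi_comm (i j : Fin n) (P : JInf n m) : shiftL i (xi j P) = shiftL j (xi i P) := by
  refine Prod.ext rfl (funext fun q => ?_)
  simp only [shiftL, xi, LinearMap.coe_mk, AddHom.coe_mk, Prod.snd_add, Pi.add_apply, Pi.zero_apply]
  have : addE (addE q.2 i) j = addE (addE q.2 j) i := by funext k; simp [addE]; omega
  rw [this]

lemma dT_comm (i j : Fin n) : Commute (dT i : S n m →ₗ[ℝ] S n m) (dT j) := by
  refine LinearMap.ext fun F => Subtype.ext (funext fun P => ?_)
  change lineDeriv ℝ (dT j F).1 P (xi i P) = lineDeriv ℝ (dT i F).1 P (xi j P)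
  rw [ld_dT, ld_dT, dV_symm, shift_xi_comm]

/-- coordinate partials -/
noncomputable def dY (σ : Fin m) (K : Fin n → ℕ) : S n m →ₗ[ℝ] S n m := dV (0, Pi.single (σ, K) 1)

lemma dY_dT (σ : Fin m) (K : Fin n → ℕ) (i : Fin n) (F : S n m) :
    dY σ K (dT i F) = dT i (dY σ K F) + if K i = 0 then 0 else dY σ (subE K i) F := by
  refine Subtype.ext (funext fun P => ?_)
  change lineDeriv ℝ (dT i F).1 P _ = lineDeriv ℝ (dY σ K F).1 P (xi i P) + _
  rw [ld_dT]
  congr 1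
  split_ifs with h
  · have : shiftL i ((0, Pi.single (σ, K) 1) : JInf n m) = 0 := by
      refine Prod.ext rfl (funext fun q => ?_)
      simp only [shiftL, LinearMap.coe_mk, AddHom.coe_mk]
      apply Pi.single_eq_of_ne
      intro hq
      have h2 := congrArg Prod.snd hq
      simp only at h2
      exact addE_self_ne q.2 i (by rw [h2]; exact h)
    rw [this]; simp [lineDeriv]
  · have : shiftL i ((0, Pi.single (σ, K) 1) : JInf n m) = (0, Pi.single (σ, subE K i) 1) := by
      refine Prod.ext rfl (funext fun q => ?_)
      simp only [shiftL, LinearMap.coe_mk, AddHom.coe_mk, Pi.single_apply]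
      have : ((q.1, addE q.2 i) = (σ, K)) ↔ q = (σ, subE K i) := by
        constructor
        · intro hq
          rw [Prod.mk.injEq] at hq
          refine Prod.ext hq.1 ?_
          rw [← hq.2, subE_addE]
        · rintro rfl
          simp [addE_subE K i h]
      simp only [this]
    rw [this]; rfl

/-- iterated total derivatives -/
noncomputable def dL (l : List (Fin n)) : Module.End ℝ (S n m) := (l.map (fun i => dT i)).prod

lemma mlist_addE (J : Fin n → ℕ) (i : Fin n) : (mlist (addE J i)).Perm (i :: mlist J) := by
  rw [List.perm_iff_count]
  have key : ∀ (J : Fin n → ℕ) a, (mlist J).count a = J a := by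
    intro J a
    rw [mlist, List.count_flatMap]
    simp only [Function.comp_def, List.count_replicate]
    rw [← Fin.sum_univ_def]
    simp
  intro a
  rw [key, List.count_cons, key]
  simp only [addE, beq_iff_eq]
  congr 1
  simp [eq_comm]

lemma dL_addE (J : Fin n → ℕ) (i : Fin n) (F : S n m) :
    dL (mlist J) (dT i F) = dL (mlist (addE J i)) F := by
  have h : ((mlist (addE J i)).Perm (mlist J ++ [i])) :=
    (mlist_addE J i).trans (by simpa using (List.perm_append_singleton i (mlist J)).symm)
  have h2 : dL (m := m) (mlist (addE J i)) = dL (mlist J ++ [i]) := by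
    unfold dL
    refine List.Perm.prod_eq' (h.map _) ?_
    rw [List.pairwise_map]
    exact List.pairwise_of_forall (fun a b => dT_comm a b)
  rw [h2]
  simp [dL]

/-- the coefficient -/
noncomputable def cf (I J : Fin n → ℕ) : ℝ :=
  (-1:ℝ)^(∑ i, J i) * (∏ i, (Nat.choose (I i + J i) (I i) : ℝ))

/-- Lie-Euler on infinite jets -/
noncomputable def EE (σ : Fin m) (I : Fin n → ℕ) (F : S n m) (P : JInf n m) : ℝ :=
  ∑' J : Fin n → ℕ, cf I J * (dL (mlist J) (dY σ (fun i => I i + J i) F)).1 P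

lemma dY_lift_zero {r : ℕ} {f : Jet n m r → ℝ} (hf : ContDiff ℝ (⊤:ℕ∞) f) (σ : Fin m)
    (K : Fin n → ℕ) (hK : ¬ ∑ i, K i ≤ r) :
    dY σ K (⟨_, r, f, hf, rfl⟩ : S n m) = 0 := by
  refine Subtype.ext (funext fun P => ?_)
  change lineDeriv ℝ _ P _ = 0
  rw [lineDeriv_lift hf]
  have : piL r ((0, Pi.single (σ, K) 1) : JInf n m) = 0 := by
    refine Prod.ext rfl (funext fun q => ?_)
    change (Pi.single (σ, K) 1 : Fin m × (Fin n → ℕ) → ℝ) (q.1, q.2.1) = 0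
    apply Pi.single_eq_of_ne
    intro hq
    have h2 := congrArg Prod.snd hq
    simp only at h2
    exact hK (h2 ▸ q.2.2)
  rw [this, map_zero]

lemma dY_bound (F : S n m) : ∃ r, ∀ σ K, (¬ ∑ i, K i ≤ r) → dY σ K F = 0 := by
  obtain ⟨_, r, f, hf, rfl⟩ := F
  exact ⟨r, fun σ K hK => dY_lift_zero hf σ K hK⟩

lemma summ_of_bound (g : (Fin n → ℕ) → ℝ) (r : ℕ) (h : ∀ J, (¬ ∑ i, J i ≤ r) → g J = 0) :
    Summable g := by
  apply summable_of_finite_support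
  refine (Set.toFinite (Set.range (fun J : MD n r => J.1))).subset ?_
  intro J hJ
  by_contra hc
  apply hJ
  apply h
  intro h'
  exact hc ⟨⟨J, h'⟩, rfl⟩

lemma EE_summable (σ : Fin m) (I : Fin n → ℕ) (F : S n m) (P : JInf n m) :
    Summable (fun J : Fin n → ℕ => cf I J * (dL (mlist J) (dY σ (fun i => I i + J i) F)).1 P) := by
  obtain ⟨r, hr⟩ := dY_bound F
  apply summ_of_bound _ r
  intro J hJ
  rw [hr]
  · simp
  · intro h; apply hJ
    rw [Finset.sum_add_distrib] at h; omega

lemma EE_sum {ι : Type*} (s : Finset ι) (σ : Fin m) (I : Fin n → ℕ) (F : ι → S n m) (P : JInf n m) :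
    EE σ I (∑ k ∈ s, F k) P = ∑ k ∈ s, EE σ I (F k) P := by
  unfold EE
  rw [← Summable.tsum_finsetSum (fun k _ => EE_summable σ I (F k) P)]
  congr 1
  funext J
  rw [map_sum, map_sum, Submodule.coe_sum, Finset.sum_apply, Finset.mul_sum]

lemma cf_split (I J : Fin n → ℕ) (i : Fin n) : cf I J = (-1:ℝ)^(∑ i, J i) *
    ((Nat.choose (I i + J i) (I i) : ℝ) *
      ∏ j ∈ Finset.univ.erase i, (Nat.choose (I j + J j) (I j) : ℝ)) := by
  rw [cf, Finset.mul_prod_erase _ (fun j => (Nat.choose (I j + J j) (I j) : ℝ)) (Finset.mem_univ i)]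

lemma prod_erase_addE (I J I' J' : Fin n → ℕ) (i : Fin n) (hI : ∀ j, j ≠ i → I j = I' j)
    (hJ : ∀ j, j ≠ i → J j = J' j) :
    ∏ j ∈ Finset.univ.erase i, (Nat.choose (I j + J j) (I j) : ℝ)
      = ∏ j ∈ Finset.univ.erase i, (Nat.choose (I' j + J' j) (I' j) : ℝ) := by
  refine Finset.prod_congr rfl fun j hj => ?_
  rw [hI j (Finset.ne_of_mem_erase hj), hJ j (Finset.ne_of_mem_erase hj)]

lemma addE_ne (J : Fin n → ℕ) (i : Fin n) : ∀ j, j ≠ i → addE J i j = J j := by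
  intro j hj; simp [addE, hj]

lemma addE_same (J : Fin n → ℕ) (i : Fin n) : addE J i i = J i + 1 := by simp [addE]

lemma cf1 (I K : Fin n → ℕ) (i : Fin n) (h : I i = 0) : cf I K + cf I (addE K i) = 0 := by
  rw [cf_split I K i, cf_split I (addE K i) i,
    prod_erase_addE I (addE K i) I K i (fun _ _ => rfl) (addE_ne K i), sum_addE, h]
  simp [pow_succ]

lemma cf2 (I K : Fin n → ℕ) (i : Fin n) (h : K i = 0) : cf (addE I i) K = cf I K := by
  rw [cf_split I K i, cf_split (addE I i) K i,
    prod_erase_addE (addE I i) K I K i (addE_ne I i) (fun _ _ => rfl), h]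
  simp

lemma cf3 (I K : Fin n → ℕ) (i : Fin n) :
    cf (addE I i) K + cf (addE I i) (addE K i) = cf I (addE K i) := by
  rw [cf_split (addE I i) K i, cf_split (addE I i) (addE K i) i, cf_split I (addE K i) i,
    prod_erase_addE (addE I i) K I K i (addE_ne I i) (fun _ _ => rfl),
    prod_erase_addE (addE I i) (addE K i) I K i (addE_ne I i) (addE_ne K i),
    prod_erase_addE I (addE K i) I K i (fun _ _ => rfl) (addE_ne K i), sum_addE,
    addE_same, addE_same]
  have : ((I i + 1 + (K i + 1)).choose (I i + 1) : ℝ)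
      = ((I i + (K i + 1)).choose (I i) : ℝ) + ((I i + 1 + K i).choose (I i + 1) : ℝ) := by
    have e : I i + 1 + (K i + 1) = (I i + (K i + 1)) + 1 := by omega
    have e2 : I i + 1 + K i = I i + (K i + 1) := by omega
    rw [e, e2, Nat.choose_succ_succ]; push_cast; ring
  rw [this, pow_succ]
  ring

lemma EE_dT (σ : Fin m) (I : Fin n → ℕ) (i : Fin n) (F : S n m) (P : JInf n m) :
    EE σ I (dT i F) P = if I i = 0 then 0 else EE σ (subE I i) F P := by
  set T : (Fin n → ℕ) → (Fin n → ℕ) → ℝ := fun J K => (dL (mlist J) (dY σ K F)).1 P with hT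
  let h : (Fin n → ℕ) → ℝ := fun K =>
    if K i = 0 then 0 else cf I (subE K i) * T K (fun j => I j + subE K i j)
  let g : (Fin n → ℕ) → ℝ := fun J =>
    cf I J * (if I i + J i = 0 then 0 else T J (subE (fun j => I j + J j) i))
  have hsplit : ∀ J, cf I J * (dL (mlist J) (dY σ (fun i => I i + J i) (dT i F))).1 P
      = h (addE J i) + g J := by
    intro J
    simp only [h, g, addE_self_ne, if_false, subE_addE]
    rw [dY_dT, map_add, dL_addE, ← mul_add]
    congr 1
    rw [Submodule.coe_add, Pi.add_apply]
    congr 1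
    split_ifs <;> simp [hT]
  obtain ⟨r, hr⟩ := dY_bound F
  have hT0 : ∀ J K, (¬ ∑ i, K i ≤ r) → T J K = 0 := by
    intro J K hK; simp [hT, hr σ K hK]
  have hle : ∀ (K J : Fin n → ℕ), (∀ j, J j ≤ K j + if j = i then 1 else 0) →
      ∑ j, J j ≤ (∑ j, K j) + 1 := by
    intro K J hJ
    rw [← sum_addE K i]
    exact Finset.sum_le_sum fun j _ => hJ j
  have hs : Summable h := by
    apply summ_of_bound _ (r+1)
    intro J hJ
    simp only [h]
    rw [hT0]
    · simp
    · intro hc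
      apply hJ
      refine (hle (fun j => I j + subE J i j) J ?_).trans (by omega)
      intro j; simp only [subE]; omega
  have gs : Summable g := by
    apply summ_of_bound _ (r+1)
    intro J hJ
    simp only [g]
    rw [hT0]
    · simp
    · intro hc
      apply hJ
      refine (hle (subE (fun j => I j + J j) i) J ?_).trans (by omega)
      intro j; simp only [subE]; omega
  have hsi : Summable (fun J => h (addE J i)) := hs.comp_injective (addE_inj i)
  have hre : ∑' J, h (addE J i) = ∑' K, h K := by
    refine (addE_inj i).tsum_eq (f := h) ?_
    intro K hK
    refine ⟨subE K i, addE_subE K i ?_⟩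
    intro h0
    apply hK
    simp [h, h0]
  unfold EE
  simp only [hsplit]
  rw [hsi.tsum_add gs, hre, ← hs.tsum_add gs]
  have hpt : ∀ K, h K + g K = if I i = 0 then 0 else
      cf (subE I i) K * T K (fun j => subE I i j + K j) := by
    intro K
    by_cases hK : K i = 0
    · by_cases hI : I i = 0
      · simp [h, g, hK, hI]
      · obtain ⟨I', rfl⟩ : ∃ I', I = addE I' i := ⟨_, (addE_subE I i hI).symm⟩
        simp only [h, g, hK, if_true, hI, if_false, subE_addE, add_zero, zero_add]
        rw [cf2 _ _ _ hK]
        congr 2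
        funext j; simp [subE, addE]; omega
    · obtain ⟨K', rfl⟩ : ∃ K', K = addE K' i := ⟨_, (addE_subE K i hK).symm⟩
      have e1 : subE (fun j => I j + addE K' i j) i = fun j => I j + K' j := by
        funext j; simp [subE, addE]; omega
      have hne : I i + addE K' i i ≠ 0 := by omega
      simp only [h, g, hK, if_false, subE_addE, e1, hne]
      rw [← add_mul]
      by_cases hI : I i = 0
      · rw [cf1 _ _ _ hI]; simp [hI]
      · obtain ⟨I', rfl⟩ : ∃ I', I = addE I' i := ⟨_, (addE_subE I i hI).symm⟩
        rw [cf3]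
        simp only [hI, if_false, subE_addE]
        congr 2
        funext j; simp [addE]; omega
  simp only [hpt]
  split_ifs
  · simp
  · rfl

lemma sum_subE (J : Fin n → ℕ) (i : Fin n) (h : J i ≠ 0) : (∑ j, subE J i j) + 1 = ∑ j, J j := by
  rw [← sum_addE _ i, addE_subE J i h]

lemma EE_dL (σ : Fin m) (l : List (Fin n)) (F : S n m) (P : JInf n m) :
    ∀ I : Fin n → ℕ, (∑ j, I j) < l.length → EE σ I (dL l F) P = 0 := by
  induction l with
  | nil => intro I h; simp at h
  | cons i l ih =>
    intro I hI
    have : dL (i :: l) F = dT i (dL l F) := by simp [dL]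
    rw [this, EE_dT]
    split_ifs with h0
    · rfl
    · apply ih
      have := sum_subE I i h0
      simp at hI
      omega

/-- lift of a smooth function -/
def lft {r : ℕ} (f : Jet n m r → ℝ) (hf : ContDiff ℝ (⊤:ℕ∞) f) : S n m := ⟨_, r, f, hf, rfl⟩

lemma formalD_eq (i : Fin n) {r : ℕ} (f : Jet n m r → ℝ) (p : Jet n m (r+1)) :
    formalD i f p = fderiv ℝ f (projJet (Nat.le_succ r) p) (xiF i r p) := by
  have hx : xiF i r p = (Pi.single i 1, 0) + ∑ q : JIdx n m r,
      yc q.1 (addE q.2.1 i) p • ((0, Pi.single q 1) : Jet n m r) := by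
    refine Prod.ext ?_ (funext fun k => ?_)
    · simp [xiF, Prod.fst_sum]
    · have hk : ∑ j, addE k.2.1 i j ≤ r + 1 := by rw [sum_addE]; exact Nat.succ_le_succ k.2.2
      rw [Prod.snd_add, Prod.snd_sum, Pi.add_apply, Finset.sum_apply, Finset.sum_eq_single k]
      · simp only [Prod.smul_snd, Pi.smul_apply, Pi.single_eq_same, Pi.zero_apply, zero_add]
        rw [yc, dif_pos hk]; simp [xiF]
      · intro b _ hb
        simp only [Prod.smul_snd, Pi.smul_apply]
        rw [Pi.single_eq_of_ne hb.symm, smul_zero]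
      · intro h; exact absurd (Finset.mem_univ _) h
  rw [hx, map_add, map_sum, formalD, pdX]
  congr 1
  refine Finset.sum_congr rfl fun q _ => ?_
  rw [map_smul, smul_eq_mul, pdY, dif_pos q.2.2]

lemma formalD_smooth (i : Fin n) {r : ℕ} {f : Jet n m r → ℝ} (hf : ContDiff ℝ (⊤:ℕ∞) f) :
    ContDiff ℝ (⊤:ℕ∞) (formalD i f) := by
  rw [funext (formalD_eq i f)]
  exact ((contDiff_fd hf).comp (contDiff_projJet _)).clm_apply (contDiff_xiF i r)

lemma formalDL_smooth (l : List (Fin n)) {r : ℕ} {f : Jet n m r → ℝ}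
    (hf : ContDiff ℝ (⊤:ℕ∞) f) : ContDiff ℝ (⊤:ℕ∞) (formalDL l f) := by
  induction l with
  | nil => exact hf
  | cons i l ih => exact formalD_smooth i ih

lemma formalDL_lift (l : List (Fin n)) {r : ℕ} {f : Jet n m r → ℝ}
    (hf : ContDiff ℝ (⊤:ℕ∞) f) :
    lft (formalDL l f) (formalDL_smooth l hf) = dL l (lft f hf) := by
  induction l with
  | nil => rfl
  | cons i l ih =>
    have : dL (i :: l) (lft f hf) = dT i (dL l (lft f hf)) := by simp [dL]
    rw [this, ← ih]
    refine Subtype.ext (funext fun P => ?_)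
    rw [dT_apply]
    change formalD i (formalDL l f) (piL _ P) = lineDeriv ℝ (fun Q => formalDL l f (piL _ Q)) P _
    rw [lineDeriv_lift (formalDL_smooth l hf), formalD_eq, piL_xi]
    rfl

lemma formalDI_lift (I : Fin n → ℕ) {r : ℕ} {f : Jet n m r → ℝ}
    (hf : ContDiff ℝ (⊤:ℕ∞) f) (P : JInf n m) :
    formalDI I f (piL _ P) = (dL (mlist I) (lft f hf)).1 P := by
  rw [← formalDL_lift]; rfl

lemma formalDI_smooth (I : Fin n → ℕ) {r : ℕ} {f : Jet n m r → ℝ}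
    (hf : ContDiff ℝ (⊤:ℕ∞) f) : ContDiff ℝ (⊤:ℕ∞) (formalDI I f) :=
  (formalDL_smooth (mlist I) hf).comp (contDiff_projJet _)

lemma pdY_smooth (σ : Fin m) (K : Fin n → ℕ) {r : ℕ} {f : Jet n m r → ℝ}
    (hf : ContDiff ℝ (⊤:ℕ∞) f) : ContDiff ℝ (⊤:ℕ∞) (pdY σ K f) := by
  unfold pdY
  split_ifs
  · exact (contDiff_fd hf).clm_apply contDiff_const
  · exact contDiff_const

lemma pdY_lift (σ : Fin m) (K : Fin n → ℕ) {r : ℕ} {f : Jet n m r → ℝ}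
    (hf : ContDiff ℝ (⊤:ℕ∞) f) (hK : ∑ i, K i ≤ r) :
    lft (pdY σ K f) (pdY_smooth σ K hf) = dY σ K (lft f hf) := by
  refine Subtype.ext (funext fun P => ?_)
  change pdY σ K f (piL r P) = lineDeriv ℝ (fun Q => f (piL r Q)) P _
  rw [lineDeriv_lift hf, pdY, dif_pos hK]
  congr 1
  refine Prod.ext rfl (funext fun q => ?_)
  simp only [piL, LinearMap.coe_mk, AddHom.coe_mk, Pi.single_apply]
  congr 1
  simp [Prod.ext_iff, Subtype.ext_iff]

lemma LieEuler_lift (σ : Fin m) (I : Fin n → ℕ) {r : ℕ} {f : Jet n m r → ℝ}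
    (hf : ContDiff ℝ (⊤:ℕ∞) f) (P : JInf n m) :
    LieEuler σ I f (piL _ P) = EE σ I (lft f hf) P := by
  have h1 : EE σ I (lft f hf) P = ∑' J : MD n r,
      cf I J.1 * (dL (mlist J.1) (dY σ (fun i => I i + J.1 i) (lft f hf))).1 P := by
    unfold EE
    symm
    refine (Subtype.val_injective (p := fun J : Fin n → ℕ => ∑ i, J i ≤ r)).tsum_eq
      (f := fun J : Fin n → ℕ =>
        cf I J * (dL (mlist J) (dY σ (fun i => I i + J i) (lft f hf))).1 P) ?_
    intro J hJ
    by_contra hc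
    apply hJ
    simp only
    rw [lft, dY_lift_zero hf]
    · simp
    · intro h
      rw [Finset.sum_add_distrib] at h
      exact hc ⟨⟨J, by omega⟩, rfl⟩
  rw [h1, tsum_fintype, LieEuler]
  refine Finset.sum_congr rfl fun J _ => ?_
  split_ifs with h
  · rw [← pdY_lift σ _ hf h, projJet_piL, formalDI_lift _ (pdY_smooth σ _ hf)]; rfl
  · rw [lft, dY_lift_zero hf σ _ h]; simp

end Infinite

/-- total divergences `f = Σ_{|I| = l} d_I A^I` are annihilated by the
Lie–Euler operators `E^J_σ` for `|J| ≤ l − 1`, and in particular by the Euler–Lagrange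
expressions. -/
theorem lieEuler_total_divergence (n m r l : ℕ) (hn : 1 ≤ n) (hm : 1 ≤ m) (hl : 1 ≤ l)
    (A : (Fin n → ℕ) → Jet n m r → ℝ) (hA : ∀ I, ContDiff ℝ (⊤:ℕ∞) (A I)) :
    (∀ (σ : Fin m) (J : Fin n → ℕ), (∑ i, J i) < l →
      ∀ p : Jet n m (2*(r+l)),
        LieEuler σ J
          (fun q : Jet n m (r + l) =>
            ∑ I : MD n l,
              if h : (∑ i, I.1 i) = l then
                formalDI I.1 (A I.1) (projJet (by omega : r + (∑ i, I.1 i) ≤ r + l) q)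
              else 0)
          p = 0) ∧
    (∀ (σ : Fin m) (p : Jet n m (2*(r+l))),
        EL σ
          (fun q : Jet n m (r + l) =>
            ∑ I : MD n l,
              if h : (∑ i, I.1 i) = l then
                formalDI I.1 (A I.1) (projJet (by omega : r + (∑ i, I.1 i) ≤ r + l) q)
              else 0)
          p = 0) := by
  set f : Jet n m (r + l) → ℝ := (fun q : Jet n m (r + l) =>
            ∑ I : MD n l,
              if h : (∑ i, I.1 i) = l then
                formalDI I.1 (A I.1) (projJet (by omega : r + (∑ i, I.1 i) ≤ r + l) q)
              else 0) with hfdef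
  have hf : ContDiff ℝ (⊤:ℕ∞) f := by
    refine ContDiff.sum fun I _ => ?_
    split_ifs with h
    · exact (formalDI_smooth I.1 (hA I.1)).comp (contDiff_projJet _)
    · exact contDiff_const
  have hlift : lft f hf = ∑ I : MD n l, if (∑ i, I.1 i) = l then
      dL (mlist I.1) (lft (A I.1) (hA I.1)) else 0 := by
    refine Subtype.ext (funext fun P => ?_)
    rw [Submodule.coe_sum, Finset.sum_apply]
    change f (piL _ P) = _
    simp only [hfdef]
    refine Finset.sum_congr rfl fun I _ => ?_
    split_ifs with h
    · rw [projJet_piL, formalDI_lift _ (hA I.1)]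
    · rfl
  have main : ∀ (σ : Fin m) (J : Fin n → ℕ), (∑ i, J i) < l →
      ∀ p : Jet n m (2*(r+l)), LieEuler σ J f p = 0 := by
    intro σ J hJ p
    obtain ⟨P, rfl⟩ := piL_surj _ p
    rw [LieEuler_lift σ J hf, hlift, EE_sum]
    refine Finset.sum_eq_zero fun I _ => ?_
    split_ifs with h
    · exact EE_dL σ _ _ P J (by rw [mlist_length]; omega)
    · simp [EE]
  exact ⟨main, fun σ p => main σ (fun _ => 0) (by simp; omega) p⟩

end JetVar
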